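/- The sequence of Apéry numbers A_n is strictly 2-log-convex: for all n ≥ 1, (A_{n-1} A_{n+1} - A_n^2)(A_{n+1} A_{n+3} - A_{n+2}^2) > (A_n A_{n+2} - A_{n+1}^2)^2. -/

import Mathlib

/-- The Apéry numbers `A_n = Σ_{k=0}^n C(n,k)^2 C(n+k,k)^2`. -/
def aperyA (n : ℕ) : ℕ :=
  ∑ k ∈ Finset.range (n + 1), (Nat.choose n k) ^ 2 * (Nat.choose (n + k) k) ^ 2

/-- The Apéry term `C(n,k) C(n+k,k)` before squaring. -/
def aperyTerm (n k : ℕ) : ℚ := (n.choose k : ℚ) * ((n + k).choose k : ℚ)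

lemma cast_choose_succ_right (n k : ℕ) :
    ((k : ℚ) + 1) * (n.choose (k + 1) : ℚ) = ((n : ℚ) - k) * (n.choose k : ℚ) := by
  rcases le_or_gt k n with h | h
  · have := Nat.choose_succ_right_eq n k
    rw [← Nat.cast_sub h]
    exact_mod_cast (by rw [mul_comm, this, mul_comm] :
      (k + 1) * n.choose (k + 1) = (n - k) * n.choose k)
  · simp [Nat.choose_eq_zero_of_lt h, Nat.choose_eq_zero_of_lt (h.trans (Nat.lt_succ_self k))]

lemma cast_succ_mul_choose (n k : ℕ) :
    ((k : ℚ) + 1) * ((n + 1).choose (k + 1) : ℚ) = ((n : ℚ) + 1) * (n.choose k : ℚ) := by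
  have := Nat.add_one_mul_choose_eq n k
  exact_mod_cast (by rw [this, mul_comm] :
    (k + 1) * (n + 1).choose (k + 1) = (n + 1) * n.choose k)

lemma cast_add_succ_choose (n k : ℕ) :
    ((n : ℚ) + 1) * ((n + 1 + k).choose k : ℚ) = ((n : ℚ) + k + 1) * ((n + k).choose k : ℚ) := by
  have h₁ := cast_succ_mul_choose (n + k) k
  have h₂ := cast_choose_succ_right (n + 1 + k) k
  have e : n + k + 1 = n + 1 + k := by omega
  rw [e] at h₁
  push_cast at h₁ h₂
  linear_combination h₁ - h₂

lemma cast_succ_sub_choose (n k : ℕ) :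
    ((n : ℚ) + 1 - k) * ((n + 1).choose k : ℚ) = ((n : ℚ) + 1) * (n.choose k : ℚ) := by
  have h₁ := cast_succ_mul_choose n k
  have h₂ := cast_choose_succ_right (n + 1) k
  push_cast at h₂
  linear_combination h₁ - h₂

lemma aperyTerm_succ_right (n k : ℕ) :
    ((k : ℚ) + 1) ^ 2 * aperyTerm n (k + 1) =
      ((n : ℚ) + k + 1) * ((n : ℚ) - k) * aperyTerm n k := by
  have h₁ := cast_choose_succ_right n k
  have h₂ := cast_succ_mul_choose (n + k) k
  unfold aperyTerm
  rw [← add_assoc]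
  push_cast at h₂
  linear_combination ((k : ℚ) + 1) * ((n + k + 1).choose (k + 1) : ℚ) * h₁ +
    ((n : ℚ) - k) * (n.choose k : ℚ) * h₂

lemma aperyTerm_succ_left (n k : ℕ) :
    ((n : ℚ) + 1 - k) * aperyTerm (n + 1) k = ((n : ℚ) + k + 1) * aperyTerm n k := by
  have h₁ := cast_succ_sub_choose n k
  have h₂ := cast_add_succ_choose n k
  unfold aperyTerm
  linear_combination ((n + 1 + k).choose k : ℚ) * h₁ + (n.choose k : ℚ) * h₂

lemma aperyTerm_succ_succ (n k : ℕ) :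
    ((k : ℚ) + 1) ^ 2 * aperyTerm (n + 1) (k + 1) =
      ((n : ℚ) + k + 1) * ((n : ℚ) + k + 2) * aperyTerm n k := by
  have h₁ := cast_succ_mul_choose n k
  have h₂ := cast_add_succ_choose n k
  have h₃ := cast_succ_mul_choose (n + 1 + k) k
  unfold aperyTerm
  rw [← add_assoc]
  push_cast at h₃
  linear_combination ((k : ℚ) + 1) * ((n + 1 + k + 1).choose (k + 1) : ℚ) * h₁ +
    ((n : ℚ) + 1) * (n.choose k : ℚ) * h₃ + ((n : ℚ) + k + 2) * (n.choose k : ℚ) * h₂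

lemma aperyTerm_pred_succ (n k : ℕ) :
    ((k : ℚ) + 1) ^ 2 * aperyTerm n (k + 1) =
      ((n : ℚ) + 1 - k) * ((n : ℚ) - k) * aperyTerm (n + 1) k := by
  linear_combination aperyTerm_succ_right n k - ((n : ℚ) - k) * aperyTerm_succ_left n k

/-- Zeilberger's certificate for the Apéry recurrence, in telescoped form. -/
lemma sum_aperyTerm_recurrence (n K : ℕ) :
    ∑ k ∈ Finset.range (K + 1),
      (((n : ℚ) + 2) ^ 3 * aperyTerm (n + 2) k ^ 2
        - (34 * ((n : ℚ) + 1) ^ 3 + 51 * ((n : ℚ) + 1) ^ 2 + 27 * ((n : ℚ) + 1) + 5)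
          * aperyTerm (n + 1) k ^ 2
        + ((n : ℚ) + 1) ^ 3 * aperyTerm n k ^ 2) =
      4 * (2 * (n : ℚ) + 3) * (K * (2 * K + 1) - (2 * (n : ℚ) + 3) ^ 2)
        * aperyTerm (n + 1) K ^ 2 := by
  induction K with
  | zero =>
    simp [aperyTerm]
    ring
  | succ k ih =>
    rw [Finset.sum_range_succ, ih]
    have hk : ((k : ℚ) + 1) ^ 2 ≠ 0 := by positivity
    have h₁ : aperyTerm (n + 1) (k + 1) = ((n : ℚ) + k + 2) * ((n : ℚ) + 1 - k)
        * aperyTerm (n + 1) k / ((k : ℚ) + 1) ^ 2 := by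
      rw [eq_div_iff hk]
      have h := aperyTerm_succ_right (n + 1) k
      push_cast at h
      linear_combination h
    have h₂ : aperyTerm (n + 2) (k + 1) = ((n : ℚ) + k + 2) * ((n : ℚ) + k + 3)
        * aperyTerm (n + 1) k / ((k : ℚ) + 1) ^ 2 := by
      rw [eq_div_iff hk]
      have h := aperyTerm_succ_succ (n + 1) k
      push_cast at h
      linear_combination h
    have h₃ : aperyTerm n (k + 1) = ((n : ℚ) + 1 - k) * ((n : ℚ) - k)
        * aperyTerm (n + 1) k / ((k : ℚ) + 1) ^ 2 := by
      rw [eq_div_iff hk]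
      linear_combination aperyTerm_pred_succ n k
    rw [h₁, h₂, h₃]
    push_cast
    field_simp
    ring

lemma aperyA_eq_sum_range (n N : ℕ) (h : n ≤ N) :
    (aperyA n : ℚ) = ∑ k ∈ Finset.range (N + 1), aperyTerm n k ^ 2 := by
  have hs : ∑ k ∈ Finset.range (n + 1), aperyTerm n k ^ 2 =
      ∑ k ∈ Finset.range (N + 1), aperyTerm n k ^ 2 := by
    apply Finset.sum_subset
    · exact Finset.range_mono (by omega)
    · intro k _ hk
      have : n < k := by simpa using hk
      simp [aperyTerm, Nat.choose_eq_zero_of_lt this]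
  rw [← hs]
  unfold aperyA aperyTerm
  push_cast
  exact Finset.sum_congr rfl fun k _ => by ring

lemma aperyA_recurrence (n : ℕ) :
    ((n : ℚ) + 2) ^ 3 * aperyA (n + 2) =
      (34 * ((n : ℚ) + 1) ^ 3 + 51 * ((n : ℚ) + 1) ^ 2 + 27 * ((n : ℚ) + 1) + 5)
        * aperyA (n + 1) - ((n : ℚ) + 1) ^ 3 * aperyA n := by
  have h := sum_aperyTerm_recurrence n (n + 2)
  have h₀ : aperyTerm (n + 1) (n + 2) = 0 := by simp [aperyTerm]
  rw [h₀, Finset.sum_add_distrib, Finset.sum_sub_distrib, ← Finset.mul_sum, ← Finset.mul_sum,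
    ← Finset.mul_sum, ← aperyA_eq_sum_range (n + 2) (n + 2) le_rfl,
    ← aperyA_eq_sum_range (n + 1) (n + 2) (by omega),
    ← aperyA_eq_sum_range n (n + 2) (by omega)] at h
  linear_combination h

lemma aperyA_pos (n : ℕ) : 0 < aperyA n := by
  unfold aperyA
  exact Finset.sum_pos (fun k hk => by
    have hkn : k ≤ n := by simpa [Nat.lt_succ_iff] using hk
    have h₁ := Nat.choose_pos hkn
    have h₂ := Nat.choose_pos (Nat.le_add_left k n)
    positivity) ⟨0, by simp⟩

lemma aperyA_mono : Monotone aperyA := by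
  refine monotone_nat_of_le_succ fun n => ?_
  unfold aperyA
  calc _ ≤ ∑ k ∈ Finset.range (n + 1), (n + 1).choose k ^ 2 * (n + 1 + k).choose k ^ 2 := by
        refine Finset.sum_le_sum fun k _ => ?_
        have h₁ := Nat.choose_le_choose k (Nat.le_succ n)
        have h₂ : (n + k).choose k ≤ (n + 1 + k).choose k :=
          Nat.choose_le_choose k (by omega)
        gcongr
    _ ≤ _ := Finset.sum_le_sum_of_subset (Finset.range_mono (by omega))

/-- A quadratic form in consecutive Apéry numbers `y = A_{m-1}`, `x = A_m` whose negativity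
bounds the ratio `x / y` from above to high order in `1 / m`. -/
def aperyForm (m x y : ℚ) : ℚ :=
  128 * m ^ 3 * x ^ 2 - (4352 * m ^ 3 - 6528 * m ^ 2 + 3456 * m - 645) * (x * y)
    + (128 * m ^ 3 - 384 * m ^ 2 + 576 * m - 597) * y ^ 2

lemma aperyForm_step (t x y z : ℚ) (ht : 0 ≤ t) (hy : 0 < y) (hxy : y ≤ x)
    (hz : (t + 3) ^ 3 * z =
      (34 * (t + 2) ^ 3 + 51 * (t + 2) ^ 2 + 27 * (t + 2) + 5) * x - (t + 2) ^ 3 * y)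
    (h : aperyForm (t + 2) x y < 0) : aperyForm (t + 3) z x < 0 := by
  have key : 128 * (t + 2) ^ 3 * (t + 3) ^ 3 * aperyForm (t + 3) z x =
      (128 * t ^ 6 + 1920 * t ^ 5 + 12096 * t ^ 4 + 41045 * t ^ 3 + 78846 * t ^ 2 + 80388 * t
      + 33212)
        * aperyForm (t + 2) x y
      - y * ((2154240 * t ^ 5 + 22044096 * t ^ 4 + 88374825 * t ^ 3 + 173626614 * t ^ 2
      + 167626260 * t + 63812268)
        * (x - y)
      + (2027520 * t ^ 5 + 20712384 * t ^ 4 + 82594800 * t ^ 3 + 160576416 * t ^ 2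
      + 152464320 * t + 56851776)
        * y) := by
    have hz' : z = ((34 * (t + 2) ^ 3 + 51 * (t + 2) ^ 2 + 27 * (t + 2) + 5) * x
        - (t + 2) ^ 3 * y) / (t + 3) ^ 3 := by
      rw [eq_div_iff (by positivity)]
      linear_combination hz
    rw [hz']
    unfold aperyForm
    field_simp
    ring
  have hd : 0 ≤ x - y := sub_nonneg.mpr hxy
  have h₁ : 0 < 128 * (t + 2) ^ 3 * (t + 3) ^ 3 := by positivity
  refine neg_of_mul_neg_right (a := 128 * (t + 2) ^ 3 * (t + 3) ^ 3) ?_ h₁.le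
  rw [key]
  refine sub_neg_of_lt (lt_of_lt_of_le (mul_neg_of_pos_of_neg (by positivity) h) (by positivity))

lemma aperyForm_neg (j : ℕ) : aperyForm ((j : ℚ) + 2) (aperyA (j + 2)) (aperyA (j + 1)) < 0 := by
  induction j with
  | zero =>
    have h₁ : aperyA 1 = 5 := by decide
    have h₂ : aperyA 2 = 73 := by decide
    norm_num [h₁, h₂, aperyForm]
  | succ j ih =>
    have hr := aperyA_recurrence (j + 1)
    push_cast at hr ⊢
    have := aperyForm_step (j : ℚ) (aperyA (j + 2)) (aperyA (j + 1)) (aperyA (j + 3))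
      (by positivity) (by exact_mod_cast aperyA_pos _)
      (by exact_mod_cast aperyA_mono (Nat.le_succ (j + 1)))
      (by linear_combination hr) ih
    convert this using 1
    ring_nf

/-- For four-term solutions of the Apéry recurrence, negativity of `aperyForm` forces strict
`2`-log-convexity. -/
lemma two_log_convex_of_aperyForm_neg (t a y x b c : ℚ) (ht : 0 ≤ t) (hy : 0 < y) (hxy : y ≤ x)
    (ha : (t + 4) ^ 3 * x =
      (34 * (t + 3) ^ 3 + 51 * (t + 3) ^ 2 + 27 * (t + 3) + 5) * y - (t + 3) ^ 3 * a)
    (hb : (t + 5) ^ 3 * b =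
      (34 * (t + 4) ^ 3 + 51 * (t + 4) ^ 2 + 27 * (t + 4) + 5) * x - (t + 4) ^ 3 * y)
    (hc : (t + 6) ^ 3 * c =
      (34 * (t + 5) ^ 3 + 51 * (t + 5) ^ 2 + 27 * (t + 5) + 5) * b - (t + 5) ^ 3 * x)
    (h : aperyForm (t + 4) x y < 0) :
    (y * b - x ^ 2) ^ 2 < (a * x - y ^ 2) * (x * c - b ^ 2) := by
  have key : (128 * (t + 4) ^ 3) ^ 3 * ((t + 3) ^ 3 * (t + 5) ^ 6 * (t + 6) ^ 3)
        * ((a * x - y ^ 2) * (x * c - b ^ 2) - (y * b - x ^ 2) ^ 2) =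
      -aperyForm (t + 4) x y
        * ((28311552 * t ^ 16 + 1994145792 * t ^ 15 + 65763459072 * t ^ 14 + 1347920265216 * t ^ 13
      + 19219373309952 * t ^ 12 + 202149716557824 * t ^ 11 + 1622482181111808 * t ^ 10
      + 10136807350812672 * t ^ 9 + 49823905055932416 * t ^ 8 + 193305606918438912 * t ^ 7
      + 590047376071327744 * t ^ 6 + 1402118329828638720 * t ^ 5
      + 2542826642479251456 * t ^ 4 + 3402434463408324608 * t ^ 3
      + 3167823833151307776 * t ^ 2 + 1833613271110778880 * t + 497088468720025600)
        * ((x - y) * (x + y))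
      + (2605056 * t ^ 15 + 171933696 * t ^ 14 + 5287747584 * t ^ 13 + 100518602112 * t ^ 12
      + 1320817928832 * t ^ 11 + 12706886476800 * t ^ 10 + 92455646922624 * t ^ 9
      + 518043975667200 * t ^ 8 + 2253550213289856 * t ^ 7 + 7610299634786688 * t ^ 6
      + 19786763262178560 * t ^ 5 + 38893677347452416 * t ^ 4 + 55943594270610432 * t ^ 3
      + 55583407402364928 * t ^ 2 + 34107112720613376 * t + 9742872498339840)
        * (x * y)
      + (28311552 * t ^ 16 + 1994145792 * t ^ 15 + 65763459072 * t ^ 14 + 1347920265216 * t ^ 13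
      + 19219269906432 * t ^ 12 + 202144507732224 * t ^ 11 + 1622362886338752 * t ^ 10
      + 10135166039166729 * t ^ 9 + 49808810290940139 * t ^ 8 + 193207966068608868 * t ^ 7
      + 589592600584878133 * t ^ 6 + 1400584931402137848 * t ^ 5
      + 2539123255895291397 * t ^ 4 + 3396214265401937717 * t ^ 3
      + 3160974332532931458 * t ^ 2 + 1829223396873213852 * t + 495875574403315144)
        * y ^ 2)
      + y ^ 3 * ((449209958400 * t ^ 15 + 27342435483648 * t ^ 14 + 772209130291200 * t ^ 13
      + 13419157141676928 * t ^ 12 + 160405375286068992 * t ^ 11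
      + 1396419810212768448 * t ^ 10 + 9140915486888158893 * t ^ 9
      + 45781848774057272727 * t ^ 8 + 176718956434628550900 * t ^ 7
      + 525092085280323474057 * t ^ 6 + 1189315245487252847064 * t ^ 5
      + 2012130357643739600409 * t ^ 4 + 2453963799594096412041 * t ^ 3
      + 2027707493621812208778 * t ^ 2 + 1008167476251726071820 * t + 224826311667013849320)
        * (x - y)
      + (435974307840 * t ^ 15 + 26556584951808 * t ^ 14 + 750561616207872 * t ^ 13
      + 13052251596429312 * t ^ 12 + 156127707878694912 * t ^ 11
      + 1360097155406194368 * t ^ 10 + 8908993137696055536 * t ^ 9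
      + 44648797752349208592 * t ^ 8 + 172452785598872662656 * t ^ 7
      + 512728079179290493680 * t ^ 6 + 1162004975954945910336 * t ^ 5
      + 1967080330078892358576 * t ^ 4 + 2400407592230062977648 * t ^ 3
      + 1984576103328321467232 * t ^ 2 + 987258860022309648192 * t + 220271893507766087040)
        * y) := by
    have ha' : a = ((34 * (t + 3) ^ 3 + 51 * (t + 3) ^ 2 + 27 * (t + 3) + 5) * y
        - (t + 4) ^ 3 * x) / (t + 3) ^ 3 := by
      rw [eq_div_iff (by positivity)]
      linear_combination ha
    have hb' : b = ((34 * (t + 4) ^ 3 + 51 * (t + 4) ^ 2 + 27 * (t + 4) + 5) * x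
        - (t + 4) ^ 3 * y) / (t + 5) ^ 3 := by
      rw [eq_div_iff (by positivity)]
      linear_combination hb
    have hc' : c = ((34 * (t + 5) ^ 3 + 51 * (t + 5) ^ 2 + 27 * (t + 5) + 5) * b
        - (t + 5) ^ 3 * x) / (t + 6) ^ 3 := by
      rw [eq_div_iff (by positivity)]
      linear_combination hc
    rw [hc', ha', hb']
    unfold aperyForm
    field_simp
    ring
  have hd : 0 ≤ x - y := sub_nonneg.mpr hxy
  have hx : 0 < x := hy.trans_le hxy
  have hq : 0 < -aperyForm (t + 4) x y := neg_pos.mpr h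
  have hp : 0 < (128 * (t + 4) ^ 3) ^ 3 * ((t + 3) ^ 3 * (t + 5) ^ 6 * (t + 6) ^ 3) := by
    positivity
  refine sub_pos.mp (pos_of_mul_pos_right (a := (128 * (t + 4) ^ 3) ^ 3
    * ((t + 3) ^ 3 * (t + 5) ^ 6 * (t + 6) ^ 3)) ?_ hp.le)
  rw [key]
  exact add_pos (mul_pos hq (by positivity)) (by positivity)

theorem aperyA_strict_two_log_convex (n : ℕ) (hn : 1 ≤ n) :
    ((aperyA (n - 1) : ℤ) * aperyA (n + 1) - (aperyA n : ℤ) ^ 2) *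
        ((aperyA (n + 1) : ℤ) * aperyA (n + 3) - (aperyA (n + 2) : ℤ) ^ 2) >
      ((aperyA n : ℤ) * aperyA (n + 2) - (aperyA (n + 1) : ℤ) ^ 2) ^ 2 := by
  rcases lt_or_ge n 3 with h | h
  · interval_cases n <;> decide
  · obtain ⟨j, rfl⟩ := Nat.exists_eq_add_of_le' h
    have h₂ := aperyA_recurrence (j + 2)
    have h₃ := aperyA_recurrence (j + 3)
    have h₄ := aperyA_recurrence (j + 4)
    have hq := aperyForm_neg (j + 2)
    push_cast at h₂ h₃ h₄ hq
    have := two_log_convex_of_aperyForm_neg (j : ℚ) (aperyA (j + 2)) (aperyA (j + 3))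
      (aperyA (j + 4)) (aperyA (j + 5)) (aperyA (j + 6)) (by positivity)
      (by exact_mod_cast aperyA_pos _) (by exact_mod_cast aperyA_mono (Nat.le_succ (j + 3)))
      (by linear_combination h₂) (by linear_combination h₃) (by linear_combination h₄)
      (by convert hq using 1; ring_nf)
    simp only [gt_iff_lt, show j + 3 - 1 = j + 2 by omega, add_assoc, Nat.reduceAdd]
    exact_mod_cast this
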